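/- DAG reformulation of the offline problem: fix a bid history H₋ = (β₋^1,…,β₋^T). Define the layered directed graph G with source s = (0,0), vertices (ℓ,j) for ℓ ∈ {1,…,m} and j ∈ {ℓ,…,M}, and sink d; directed edges from (ℓ−1,j) to (ℓ,j') for every ℓ ∈ {1,…,m} and j < j', with edge weight ∑_{t=1}^{T} ∑_{k=j+1}^{j'} v_k · 1{w_{j'} ≥ (β₋^t)^{-(k)}}; and a directed edge of weight 0 from every (ℓ,j) to d. Then the map sending a directed s–d path s → (1,z_1) → … → (k,z_k) → d (k ∈ {1,…,m}) to the strategy in 𝒫*_k determined by Q_ℓ = z_ℓ (ℓ ∈ {1,…,k}) is a bijection between the set of s–d paths of G and 𝒫*_{≤m}, and the total edge weight of each s–d path equals ∑_{t=1}^{T} V(b;β₋^t) for the corresponding strategy b. In particular, max_{b ∈ 𝒫*_{≤m}} ∑_{t=1}^{T} V(b;β₋^t) equals the maximum weight of an s–d path in G. -/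

import Mathlib

open Finset

namespace Auction

/-- A competing-bid profile for an auction of `K` identical units, represented by the
function sending `j ∈ {1,…,K}` to the `j`-th smallest element of the multiset of the
`K` largest competing bids. -/
structure Profile (K : ℕ) where
  c : ℕ → ℝ
  mono : ∀ i j : ℕ, 1 ≤ i → i ≤ j → j ≤ K → c i ≤ c j
  nonneg : ∀ j : ℕ, 1 ≤ j → j ≤ K → 0 ≤ c j

/-- A bid vector: `n` units are demanded and `bid j` is the bid for the `j`-th unit
(for `1 ≤ j ≤ n`). -/
structure BidVec where
  n : ℕ
  bid : ℕ → ℝ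

/-- A bid vector is valid if its bids are non-increasing and positive. -/
def BidVec.Valid (b : BidVec) : Prop :=
  (∀ i j : ℕ, 1 ≤ i → i ≤ j → j ≤ b.n → b.bid j ≤ b.bid i) ∧
  ∀ j : ℕ, 1 ≤ j → j ≤ b.n → 0 < b.bid j

open Classical in
/-- The number of units the bidder wins (ties broken in the bidder's favor): the
largest `r ≤ min n K` such that the bidder's `j`-th bid is at least the `j`-th
threshold `β.c j` for every `j ≤ r`. -/
noncomputable def alloc (K : ℕ) (b : BidVec) (β : Profile K) : ℕ :=
  ((Finset.Icc 1 (min b.n K)).filter fun r => ∀ j ∈ Finset.Icc 1 r, β.c j ≤ b.bid j).sup id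

/-- The clearing price: the `K`-th highest among all submitted bids (taken to be `0`
when the bidder wins no unit). -/
noncomputable def price (K : ℕ) (b : BidVec) (β : Profile K) : ℝ :=
  if alloc K b β = 0 then 0
  else if alloc K b β < K then min (b.bid (alloc K b β)) (β.c (alloc K b β + 1))
  else b.bid K

/-- The value obtained by the bidder. -/
noncomputable def value (v : ℕ → ℝ) (K : ℕ) (b : BidVec) (β : Profile K) : ℝ :=
  ∑ j ∈ Finset.Icc 1 (alloc K b β), v j

/-- The bidder's total payment. -/
noncomputable def payment (K : ℕ) (b : BidVec) (β : Profile K) : ℝ :=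
  price K b β * (alloc K b β : ℝ)

/-- The RoI constraint (with target RoI `γ = 0`) against a single competing-bid profile. -/
def Feasible (v : ℕ → ℝ) (K : ℕ) (b : BidVec) (β : Profile K) : Prop :=
  payment K b β ≤ value v K b β

/-- A bid vector is safe if it satisfies the RoI constraint against every profile. -/
def Safe (v : ℕ → ℝ) (K : ℕ) (b : BidVec) : Prop :=
  ∀ β : Profile K, Feasible v K b β

/-- A valuation vector: nonnegative and non-increasing on `{1,…,M}`. -/
def ValidValuation (M : ℕ) (v : ℕ → ℝ) : Prop :=
  (∀ j : ℕ, 1 ≤ j → j ≤ M → 0 ≤ v j) ∧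
  ∀ i j : ℕ, 1 ≤ i → i ≤ j → j ≤ M → v j ≤ v i

/-- The average cumulative valuation `w_j = (v_1 + ⋯ + v_j) / j`. -/
noncomputable def w (v : ℕ → ℝ) (j : ℕ) : ℝ :=
  (∑ ℓ ∈ Finset.Icc 1 j, v ℓ) / (j : ℝ)

/-- An `m`-uniform bidding strategy: bid-quantity pairs `(b j, q j)` for `1 ≤ j ≤ m`. -/
structure Uniform where
  m : ℕ
  b : ℕ → ℝ
  q : ℕ → ℕ

/-- Cumulative quantities `Q j = q 1 + ⋯ + q j`. -/
def Uniform.Q (s : Uniform) (j : ℕ) : ℕ := ∑ ℓ ∈ Finset.Icc 1 j, s.q ℓ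

/-- `s` is a genuine `m`-uniform strategy for maximum demand `M`:
`b 1 > b 2 > ⋯ > b m > 0`, positive quantities, and `Q m ≤ M`. -/
def Uniform.IsUniform (M : ℕ) (s : Uniform) : Prop :=
  1 ≤ s.m ∧
  (∀ j : ℕ, 1 ≤ j → j ≤ s.m → 0 < s.q j) ∧
  0 < s.b s.m ∧
  (∀ j : ℕ, 1 ≤ j → j < s.m → s.b (j + 1) < s.b j) ∧
  s.Q s.m ≤ M

/-- The bid vector associated to a uniform strategy: the bid on the `j`-th unit is
`b ℓ`, where `ℓ` is least with `j ≤ Q ℓ`. -/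
noncomputable def Uniform.toBidVec (s : Uniform) : BidVec :=
  ⟨s.Q s.m, fun j => s.b (sInf {ℓ : ℕ | j ≤ s.Q ℓ})⟩

/-- The 1-uniform strategy bidding `b` on `q` units. -/
def single (b : ℝ) (q : ℕ) : Uniform := ⟨1, fun _ => b, fun _ => q⟩

/-- Membership in the class `𝒫*_{≤ m}` of safe undominated strategies with at most `m`
bid-quantity pairs: strategies determined by a tuple `0 < Q 1 < ⋯ < Q k ≤ M` (`k ≤ m`)
via `b ℓ = w (Q ℓ)` and `q ℓ = Q ℓ - Q (ℓ-1)`. -/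
def InSafeClass (M : ℕ) (v : ℕ → ℝ) (m : ℕ) (s : Uniform) : Prop :=
  1 ≤ s.m ∧ s.m ≤ m ∧ (∀ j : ℕ, 1 ≤ j → j ≤ s.m → 0 < s.q j) ∧ s.Q s.m ≤ M ∧
  ∀ ℓ : ℕ, 1 ≤ ℓ → ℓ ≤ s.m → s.b ℓ = w v (s.Q ℓ)

/-- Membership in the class `𝒬_{≤ m}(H)` of strategies with at most `m` bid-quantity
pairs that are RoI-feasible for the bid history `H` over rounds `1,…,T`. -/
def InFeasClass (M : ℕ) (v : ℕ → ℝ) (K T : ℕ) (H : ℕ → Profile K) (m : ℕ) (s : Uniform) : Prop :=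
  s.IsUniform M ∧ s.m ≤ m ∧ ∀ t ∈ Finset.Icc 1 T, Feasible v K s.toBidVec (H t)

/-- Total value obtained by strategy `s` over the bid history `H` on rounds `1,…,T`. -/
noncomputable def totalValue (v : ℕ → ℝ) (K T : ℕ) (H : ℕ → Profile K) (s : Uniform) : ℝ :=
  ∑ t ∈ Finset.Icc 1 T, value v K s.toBidVec (H t)

/-- The optimal total value over the class `𝒫*_{≤ m}`. -/
noncomputable def bestSafe (M : ℕ) (v : ℕ → ℝ) (K T : ℕ) (H : ℕ → Profile K) (m : ℕ) : ℝ :=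
  sSup {x : ℝ | ∃ s : Uniform, InSafeClass M v m s ∧ x = totalValue v K T H s}

/-- The optimal total value over the class `𝒬_{≤ m}(H)`. -/
noncomputable def bestFeas (M : ℕ) (v : ℕ → ℝ) (K T : ℕ) (H : ℕ → Profile K) (m : ℕ) : ℝ :=
  sSup {x : ℝ | ∃ s : Uniform, InFeasClass M v K T H m s ∧ x = totalValue v K T H s}

/-- Data of an `s`–`d` path `s → (1, z 1) → ⋯ → (k, z k) → d` in the layered DAG. -/
structure PathData where
  k : ℕ
  z : ℕ → ℕ

/-- Validity of a path: `1 ≤ k ≤ m`, `z 0 = 0`, `z` strictly increasing, `z k ≤ M`. -/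
def PathData.Valid (m M : ℕ) (p : PathData) : Prop :=
  1 ≤ p.k ∧ p.k ≤ m ∧ p.z 0 = 0 ∧
  (∀ ℓ : ℕ, 1 ≤ ℓ → ℓ ≤ p.k → p.z (ℓ - 1) < p.z ℓ) ∧ p.z p.k ≤ M

/-- Weight of the edge `(ℓ-1, j) → (ℓ, j')` of the DAG:
`∑_{t=1}^{T} ∑_{k=j+1}^{j'} v k · 1{w j' ≥ (β^t)^{-(k)}}`. -/
noncomputable def edgeWeight (v : ℕ → ℝ) (K T : ℕ) (H : ℕ → Profile K) (j j' : ℕ) : ℝ :=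
  ∑ t ∈ Finset.Icc 1 T, ∑ k ∈ Finset.Icc (j + 1) j',
    if (H t).c k ≤ w v j' then v k else 0

/-- Total weight of an `s`–`d` path (edges into `d` have weight `0`). -/
noncomputable def pathWeight (v : ℕ → ℝ) (K T : ℕ) (H : ℕ → Profile K) (p : PathData) : ℝ :=
  ∑ ℓ ∈ Finset.Icc 1 p.k, edgeWeight v K T H (p.z (ℓ - 1)) (p.z ℓ)

/-- The strategy in `𝒫*` corresponding to a path: `Q ℓ = z ℓ`, `b ℓ = w (z ℓ)`,
`q ℓ = z ℓ - z (ℓ-1)`. -/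
noncomputable def pathToUniform (v : ℕ → ℝ) (p : PathData) : Uniform :=
  ⟨p.k, fun ℓ => w v (p.z ℓ), fun ℓ => p.z ℓ - p.z (ℓ - 1)⟩

/-- The average cumulative valuation is non-increasing in the number of units. -/
theorem w_anti {M : ℕ} {v : ℕ → ℝ} (hv : ValidValuation M v) {i j : ℕ} (hi : 1 ≤ i)
    (hij : i ≤ j) (hj : j ≤ M) : w v j ≤ w v i := by
  induction j, hij using Nat.le_induction with
  | base => exact le_rfl
  | succ j hij ih =>
    refine le_trans ?_ (ih (by omega))
    have hsum : (j : ℝ) * v (j + 1) ≤ ∑ ℓ ∈ Finset.Icc 1 j, v ℓ := by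
      have h := Finset.card_nsmul_le_sum (Finset.Icc 1 j) v (v (j + 1)) fun x hx => by
        rw [Finset.mem_Icc] at hx
        exact hv.2 x (j + 1) hx.1 (by omega) hj
      simpa using h
    have hpos : (0 : ℝ) < j := by exact_mod_cast (by omega : 0 < j)
    unfold w
    rw [Finset.sum_Icc_succ_top (by omega : 1 ≤ j + 1), div_le_div_iff₀ (by positivity) hpos]
    push_cast
    nlinarith

theorem Uniform.Q_zero (s : Uniform) : s.Q 0 = 0 := by
  simp [Uniform.Q]

theorem Uniform.Q_succ (s : Uniform) (j : ℕ) : s.Q (j + 1) = s.Q j + s.q (j + 1) :=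
  Finset.sum_Icc_succ_top (by omega) _

theorem Uniform.Q_mono (s : Uniform) : Monotone s.Q :=
  monotone_nat_of_le_succ fun j => by rw [s.Q_succ]; omega

/-- The bid on a unit of the `ℓ`-th block is `s.b ℓ`. -/
theorem Uniform.toBidVec_bid (s : Uniform) {ℓ j : ℕ} (h₁ : s.Q (ℓ - 1) < j) (h₂ : j ≤ s.Q ℓ) :
    s.toBidVec.bid j = s.b ℓ := by
  have h : sInf {ℓ : ℕ | j ≤ s.Q ℓ} = ℓ := by
    refine le_antisymm (Nat.sInf_le h₂) ?_
    by_contra! hlt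
    have hmem : j ≤ s.Q (sInf {ℓ : ℕ | j ≤ s.Q ℓ}) :=
      Nat.sInf_mem (s := {ℓ : ℕ | j ≤ s.Q ℓ}) ⟨ℓ, h₂⟩
    have := s.Q_mono (show sInf {ℓ : ℕ | j ≤ s.Q ℓ} ≤ ℓ - 1 by omega)
    omega
  exact congrArg s.b h

/-- The bids of a strategy in the safe class are non-increasing. -/
theorem InSafeClass.bid_anti {M m : ℕ} {v : ℕ → ℝ} (hv : ValidValuation M v) {s : Uniform}
    (hs : InSafeClass M v m s) {i j : ℕ} (hi : 1 ≤ i) (hij : i ≤ j) (hj : j ≤ s.Q s.m) :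
    s.toBidVec.bid j ≤ s.toBidVec.bid i := by
  have hmi : i ≤ s.Q (sInf {ℓ : ℕ | i ≤ s.Q ℓ}) :=
    Nat.sInf_mem (s := {ℓ : ℕ | i ≤ s.Q ℓ}) ⟨s.m, hij.trans hj⟩
  have hmj : j ≤ s.Q (sInf {ℓ : ℕ | j ≤ s.Q ℓ}) :=
    Nat.sInf_mem (s := {ℓ : ℕ | j ≤ s.Q ℓ}) ⟨s.m, hj⟩
  have hle : sInf {ℓ : ℕ | i ≤ s.Q ℓ} ≤ sInf {ℓ : ℕ | j ≤ s.Q ℓ} :=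
    Nat.sInf_le (hij.trans hmj)
  have hm : sInf {ℓ : ℕ | j ≤ s.Q ℓ} ≤ s.m := Nat.sInf_le hj
  change s.b (sInf {ℓ : ℕ | j ≤ s.Q ℓ}) ≤ s.b (sInf {ℓ : ℕ | i ≤ s.Q ℓ})
  generalize sInf {ℓ : ℕ | i ≤ s.Q ℓ} = a at *
  generalize sInf {ℓ : ℕ | j ≤ s.Q ℓ} = c at *
  have ha : 1 ≤ a := by
    by_contra! h
    obtain rfl : a = 0 := by omega
    rw [s.Q_zero] at hmi
    omega
  rw [hs.2.2.2.2 a ha (hle.trans hm), hs.2.2.2.2 c (ha.trans hle) hm]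
  exact w_anti hv (hi.trans hmi) (s.Q_mono hle) ((s.Q_mono hm).trans hs.2.2.2.1)

/-- If bids are non-increasing and at most `K` units are demanded, a unit is won exactly when
its bid meets the corresponding threshold. -/
theorem le_alloc_iff {K : ℕ} {b : BidVec} (β : Profile K) (hn : b.n ≤ K)
    (hb : ∀ i j : ℕ, 1 ≤ i → i ≤ j → j ≤ b.n → b.bid j ≤ b.bid i) {k : ℕ} (hk : 1 ≤ k)
    (hkn : k ≤ b.n) : k ≤ alloc K b β ↔ β.c k ≤ b.bid k := by
  unfold alloc
  constructor
  · intro h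
    obtain ⟨r, hr, hkr⟩ := (Finset.le_sup_iff (show (⊥ : ℕ) < k from hk)).1 h
    exact ((@Finset.mem_filter _ _ (_) _ _).1 hr).2 k (Finset.mem_Icc.2 ⟨hk, hkr⟩)
  · intro h
    refine Finset.le_sup (f := id)
      ((@Finset.mem_filter _ _ (_) _ _).2 ⟨Finset.mem_Icc.2 ⟨hk, by omega⟩, ?_⟩)
    intro j hj
    rw [Finset.mem_Icc] at hj
    exact (β.mono j k hj.1 hj.2 (by omega)).trans (h.trans (hb j k hj.1 hj.2 hkn))

theorem alloc_le (K : ℕ) (b : BidVec) (β : Profile K) : alloc K b β ≤ b.n := by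
  refine Finset.sup_le fun r hr => ?_
  have := (Finset.mem_Icc.1 ((@Finset.mem_filter _ _ (_) _ _).1 hr).1).2
  simp only [id]
  omega

theorem value_eq_sum_ite (v : ℕ → ℝ) {K : ℕ} {b : BidVec} (β : Profile K) (hn : b.n ≤ K)
    (hb : ∀ i j : ℕ, 1 ≤ i → i ≤ j → j ≤ b.n → b.bid j ≤ b.bid i) :
    value v K b β = ∑ k ∈ Finset.Icc 1 b.n, if β.c k ≤ b.bid k then v k else 0 := by
  rw [← Finset.sum_filter, value]
  refine Finset.sum_congr (Finset.ext fun k => ?_) fun _ _ => rfl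
  rw [Finset.mem_filter, Finset.mem_Icc, Finset.mem_Icc]
  constructor
  · rintro ⟨h1, h2⟩
    have h3 := h2.trans (alloc_le K b β)
    exact ⟨⟨h1, h3⟩, (le_alloc_iff β hn hb h1 h3).1 h2⟩
  · rintro ⟨⟨h1, h2⟩, h3⟩
    exact ⟨h1, (le_alloc_iff β hn hb h1 h2).2 h3⟩

/-- A sum over the demanded units splits into the blocks of a uniform strategy. -/
theorem Uniform.sum_Icc_Q (s : Uniform) (f : ℕ → ℝ) (n : ℕ) :
    ∑ k ∈ Finset.Icc 1 (s.Q n), f k =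
      ∑ ℓ ∈ Finset.Icc 1 n, ∑ k ∈ Finset.Icc (s.Q (ℓ - 1) + 1) (s.Q ℓ), f k := by
  induction n with
  | zero => simp [s.Q_zero]
  | succ n ih =>
    rw [Finset.sum_Icc_succ_top (by omega : 1 ≤ n + 1), ← ih, Nat.add_sub_cancel]
    have hle := s.Q_mono (Nat.le_succ n)
    rw [← Finset.sum_union]
    · refine Finset.sum_congr (Finset.ext fun k => ?_) fun _ _ => rfl
      simp only [Finset.mem_union, Finset.mem_Icc, Nat.succ_eq_add_one] at hle ⊢
      omega
    · rw [Finset.disjoint_left]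
      intro k h₁ h₂
      rw [Finset.mem_Icc] at h₁ h₂
      omega

theorem InSafeClass.totalValue_eq {K M m : ℕ} {v : ℕ → ℝ} (hv : ValidValuation M v)
    (hMK : M ≤ K) (T : ℕ) (H : ℕ → Profile K) {s : Uniform} (hs : InSafeClass M v m s) :
    totalValue v K T H s =
      ∑ ℓ ∈ Finset.Icc 1 s.m, edgeWeight v K T H (s.Q (ℓ - 1)) (s.Q ℓ) := by
  unfold totalValue edgeWeight
  rw [Finset.sum_comm]
  refine Finset.sum_congr rfl fun t _ => ?_
  rw [value_eq_sum_ite v (H t) (show s.Q s.m ≤ K from hs.2.2.2.1.trans hMK)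
    fun i j hi hij hj => hs.bid_anti hv hi hij hj]
  change ∑ k ∈ Finset.Icc 1 (s.Q s.m), _ = _
  rw [s.sum_Icc_Q]
  refine Finset.sum_congr rfl fun ℓ hℓ => Finset.sum_congr rfl fun k hk => ?_
  rw [Finset.mem_Icc] at hℓ hk
  rw [s.toBidVec_bid (Nat.lt_of_succ_le hk.1) hk.2, hs.2.2.2.2 ℓ hℓ.1 hℓ.2]

theorem PathData.Valid.Q_eq {m M : ℕ} {p : PathData} (hp : p.Valid m M) (v : ℕ → ℝ) {ℓ : ℕ}
    (hℓ : ℓ ≤ p.k) : (pathToUniform v p).Q ℓ = p.z ℓ := by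
  induction ℓ with
  | zero => rw [Uniform.Q_zero, hp.2.2.1]
  | succ n ih =>
    have h := hp.2.2.2.1 (n + 1) (by omega) hℓ
    rw [Uniform.Q_succ, ih (by omega)]
    simp only [pathToUniform, Nat.add_sub_cancel] at h ⊢
    omega

theorem PathData.Valid.inSafeClass {m M : ℕ} {p : PathData} (hp : p.Valid m M) (v : ℕ → ℝ) :
    InSafeClass M v m (pathToUniform v p) :=
  ⟨hp.1, hp.2.1, fun j h₁ h₂ => Nat.sub_pos_of_lt (hp.2.2.2.1 j h₁ h₂),
    (hp.Q_eq v le_rfl).trans_le hp.2.2.2.2,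
    fun _ _ h₂ => congrArg (w v) (hp.Q_eq v h₂).symm⟩

theorem PathData.Valid.pathWeight_eq {K M m : ℕ} {v : ℕ → ℝ} (hv : ValidValuation M v)
    (hMK : M ≤ K) (T : ℕ) (H : ℕ → Profile K) {p : PathData} (hp : p.Valid m M) :
    pathWeight v K T H p = totalValue v K T H (pathToUniform v p) := by
  rw [(hp.inSafeClass v).totalValue_eq hv hMK]
  refine Finset.sum_congr rfl fun ℓ hℓ => ?_
  have hle := (Finset.mem_Icc.1 hℓ).2
  rw [hp.Q_eq v hle, hp.Q_eq v ((Nat.sub_le ℓ 1).trans hle)]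

/-- The cumulative quantities of a strategy in the safe class form a valid path. -/
theorem InSafeClass.path_valid {M m : ℕ} {v : ℕ → ℝ} {s : Uniform} (hs : InSafeClass M v m s) :
    PathData.Valid m M ⟨s.m, s.Q⟩ := by
  refine ⟨hs.1, hs.2.1, s.Q_zero, fun ℓ h₁ h₂ => ?_, hs.2.2.2.1⟩
  obtain ⟨n, rfl⟩ := Nat.exists_eq_add_of_le' h₁
  have := hs.2.2.1 (n + 1) h₁ h₂
  simp only [Nat.add_sub_cancel, s.Q_succ]
  omega

/-- Theorem `thm:DAG-base-strategy`: the map sending an `s`–`d` path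
of the layered DAG to the corresponding strategy is a bijection onto `𝒫*_{≤ m}`; the
weight of each path equals the total value of the corresponding strategy, and hence
the optimal offline value equals the maximum weight of an `s`–`d` path. -/
theorem dag_reformulation
    (K M : ℕ) (v : ℕ → ℝ) (hv : ValidValuation M v) (hMK : M ≤ K)
    (m T : ℕ) (hm : 1 ≤ m) (H : ℕ → Profile K) :
    (∀ p : PathData, p.Valid m M →
        InSafeClass M v m (pathToUniform v p) ∧
        pathWeight v K T H p = totalValue v K T H (pathToUniform v p)) ∧
    (∀ s : Uniform, InSafeClass M v m s →
        ∃ p : PathData, p.Valid m M ∧ p.k = s.m ∧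
          (∀ ℓ : ℕ, 1 ≤ ℓ → ℓ ≤ s.m → p.z ℓ = s.Q ℓ) ∧
          pathWeight v K T H p = totalValue v K T H s) ∧
    sSup {x : ℝ | ∃ p : PathData, p.Valid m M ∧ x = pathWeight v K T H p} =
      bestSafe M v K T H m := by
  refine ⟨fun p hp => ⟨hp.inSafeClass v, hp.pathWeight_eq hv hMK T H⟩,
    fun s hs => ⟨⟨s.m, s.Q⟩, hs.path_valid, rfl, fun _ _ _ => rfl,
      (hs.totalValue_eq hv hMK T H).symm⟩, congrArg sSup (Set.ext fun x => ?_)⟩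
  constructor
  · rintro ⟨p, hp, rfl⟩
    exact ⟨pathToUniform v p, hp.inSafeClass v, hp.pathWeight_eq hv hMK T H⟩
  · rintro ⟨s, hs, rfl⟩
    exact ⟨⟨s.m, s.Q⟩, hs.path_valid, hs.totalValue_eq hv hMK T H⟩

end Auction
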